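/- (Inverse of the elliptic Cauchy matrix.) Let N ≥ 1, let x_1,…,x_N, y_1,…,y_N, α ∈ ℂ, and let τ ∈ ℂ with Im τ > 0. Assume θ1(α;τ) ≠ 0, θ1(x_i − y_j;τ) ≠ 0 for all i,j, θ1(x_i − x_j;τ) ≠ 0 and θ1(y_i − y_j;τ) ≠ 0 for all i ≠ j, and θ1(∑_i x_i − ∑_i y_i + α;τ) ≠ 0. Then the matrix Ṽ with entries Ṽ_{ij} = θ1(x_i − y_j + α;τ)/(θ1(x_i − y_j;τ)·θ1(α;τ)) is invertible, and for all m, n: (Ṽ^{−1})_{mn} = −[θ1(∑_{i≠n} x_i − ∑_{i≠m} y_i + α;τ)/(θ1(∑_i x_i − ∑_i y_i + α;τ)·θ1(x_n − y_m;τ))] · [∏_{i=1}^N θ1(x_n − y_i;τ) · ∏_{i=1}^N θ1(y_m − x_i;τ)] / [∏_{i≠n} θ1(x_n − x_i;τ) · ∏_{i≠m} θ1(y_m − y_i;τ)]. -/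

import Mathlib

open Finset

noncomputable section

/-- The Jacobi theta function
`θ1(z;τ) = −i ∑_{n∈ℤ} (−1)^n exp(iπτ(n+1/2)²)·e^{(2n+1)iz}`. -/
def jacobiTheta1 (z τ : ℂ) : ℂ :=
  -Complex.I * ∑' n : ℤ,
    (-1 : ℂ) ^ n *
      Complex.exp ((Real.pi : ℂ) * Complex.I * τ * ((n : ℂ) + 2⁻¹) ^ 2) *
      Complex.exp ((2 * (n : ℂ) + 1) * Complex.I * z)

lemma jacobiTheta1_term_eq (n : ℤ) (z τ : ℂ) :
    (-1 : ℂ) ^ n *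
      Complex.exp ((Real.pi : ℂ) * Complex.I * τ * ((n : ℂ) + 2⁻¹) ^ 2) *
      Complex.exp ((2 * (n : ℂ) + 1) * Complex.I * z) =
    Complex.exp (Real.pi * Complex.I * τ / 4 + Complex.I * z) *
      jacobiTheta₂_term n (z / Real.pi + τ / 2 + 1 / 2) τ := by
  have hπ : (Real.pi : ℂ) ≠ 0 := by exact_mod_cast Real.pi_ne_zero
  rw [jacobiTheta₂_term, ← Complex.exp_pi_mul_I, ← Complex.exp_int_mul, ← Complex.exp_add,
    ← Complex.exp_add, ← Complex.exp_add]
  congr 1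
  field_simp
  ring

lemma jacobiTheta1_eq_jacobiTheta₂ (z τ : ℂ) :
    jacobiTheta1 z τ = -Complex.I * (Complex.exp (Real.pi * Complex.I * τ / 4 + Complex.I * z) *
      jacobiTheta₂ (z / Real.pi + τ / 2 + 1 / 2) τ) := by
  simp only [jacobiTheta1, jacobiTheta1_term_eq, tsum_mul_left, jacobiTheta₂]

lemma differentiable_jacobiTheta1 {τ : ℂ} (hτ : 0 < τ.im) :
    Differentiable ℂ fun z => jacobiTheta1 z τ := by
  simp only [jacobiTheta1_eq_jacobiTheta₂]
  have h : Differentiable ℂ fun z => jacobiTheta₂ z τ :=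
    fun z => differentiableAt_jacobiTheta₂_fst z hτ
  have h' : Differentiable ℂ fun z : ℂ => jacobiTheta₂ (z / Real.pi + τ / 2 + 1 / 2) τ :=
    h.comp (f := fun z : ℂ => z / Real.pi + τ / 2 + 1 / 2) (by fun_prop)
  fun_prop

lemma jacobiTheta1_mul_term (n m : ℤ) (x z τ : ℂ) :
    ((-1 : ℂ) ^ n *
      Complex.exp ((Real.pi : ℂ) * Complex.I * τ * ((n : ℂ) + 2⁻¹) ^ 2) *
      Complex.exp ((2 * (n : ℂ) + 1) * Complex.I * (x + z))) *
    ((-1 : ℂ) ^ m *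
      Complex.exp ((Real.pi : ℂ) * Complex.I * τ * ((m : ℂ) + 2⁻¹) ^ 2) *
      Complex.exp ((2 * (m : ℂ) + 1) * Complex.I * (x - z))) =
    (-1 : ℂ) ^ (n + m) * (jacobiTheta₂_term (n + m + 1) (x / Real.pi) (τ / 2) *
      jacobiTheta₂_term (n - m) (z / Real.pi) (τ / 2)) := by
  have hπ : (Real.pi : ℂ) ≠ 0 := by exact_mod_cast Real.pi_ne_zero
  have h (a b c d e f : ℂ) : (a * b * c) * (d * e * f) = (a * d) * ((b * c) * (e * f)) := by ring
  rw [h, ← zpow_add₀ (by norm_num), jacobiTheta₂_term, jacobiTheta₂_term]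
  simp only [← Complex.exp_add]
  congr 2
  push_cast
  field_simp
  ring

/-- The part of the series of `jacobiTheta₂ (z / π) (τ / 2)` with index in `s`. -/
def partialTheta (s : Set ℤ) (z τ : ℂ) : ℂ :=
  ∑' n : ℤ, s.indicator (fun n => jacobiTheta₂_term n (z / Real.pi) (τ / 2)) n

/-- The addition formula for `θ1`, with the theta functions of modulus `2τ`
written as even and odd parts of one series. -/
lemma jacobiTheta1_add_mul_sub {τ : ℂ} (hτ : 0 < τ.im) (x z : ℂ) :
    jacobiTheta1 (x + z) τ * jacobiTheta1 (x - z) τ =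
      partialTheta {n | Even n} x τ * partialTheta {n | Odd n} z τ -
        partialTheta {n | Odd n} x τ * partialTheta {n | Even n} z τ := by
  have hτ2 : 0 < (τ / 2).im := by
    have : (τ / 2).im = τ.im / 2 := by simp
    rw [this]; positivity
  have hs (w : ℂ) : Summable fun n : ℤ => ‖(-1 : ℂ) ^ n *
      Complex.exp ((Real.pi : ℂ) * Complex.I * τ * ((n : ℂ) + 2⁻¹) ^ 2) *
      Complex.exp ((2 * (n : ℂ) + 1) * Complex.I * w)‖ := by
    simp only [jacobiTheta1_term_eq]
    exact (((summable_jacobiTheta₂_term_iff _ τ).2 hτ).mul_left _).norm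
  have hp (s : Set ℤ) (w : ℂ) : Summable fun n : ℤ =>
      ‖s.indicator (fun n => jacobiTheta₂_term n (w / Real.pi) (τ / 2)) n‖ :=
    (((summable_jacobiTheta₂_term_iff _ _).2 hτ2).indicator s).norm
  have hL : jacobiTheta1 (x + z) τ * jacobiTheta1 (x - z) τ = ∑' p : ℤ × ℤ,
      -((-1 : ℂ) ^ (p.1 + p.2) * (jacobiTheta₂_term (p.1 + p.2 + 1) (x / Real.pi) (τ / 2) *
      jacobiTheta₂_term (p.1 - p.2) (z / Real.pi) (τ / 2))) := by
    rw [jacobiTheta1, jacobiTheta1, mul_mul_mul_comm,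
      tsum_mul_tsum_of_summable_norm (hs _) (hs _), tsum_neg]
    simp [jacobiTheta1_mul_term]
  have hprod (s t : Set ℤ) := (summable_mul_of_summable_norm (hp s x) (hp t z))
  rw [hL, partialTheta, partialTheta, partialTheta, partialTheta,
    tsum_mul_tsum_of_summable_norm (hp _ _) (hp _ _),
    tsum_mul_tsum_of_summable_norm (hp _ _) (hp _ _),
    ← (hprod _ _).tsum_sub (hprod _ _)]
  have hinj : Function.Injective fun p : ℤ × ℤ => (p.1 + p.2 + 1, p.1 - p.2) := by
    rintro ⟨a, b⟩ ⟨c, d⟩ h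
    simp only [Prod.mk.injEq] at h ⊢
    omega
  refine Eq.trans ?_ (hinj.tsum_eq ?_)
  · refine tsum_congr fun ⟨n, m⟩ => ?_
    rcases Int.even_or_odd (n + m) with h | h
    · have h1 : Odd (n + m + 1) := h.add_one
      have h2 : Even (n - m) := by grind
      have h3 : ¬ Even (n + m + 1) := Int.not_even_iff_odd.2 h1
      simp [Set.indicator, h1, h2, h3, h.neg_one_zpow]
    · have h1 : Even (n + m + 1) := h.add_one
      have h2 : Odd (n - m) := by grind
      have h3 : ¬ Odd (n + m + 1) := Int.not_odd_iff_even.2 h1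
      simp [Set.indicator, h1, h2, h3, h.neg_one_zpow]
  · rintro ⟨p, r⟩ hpr
    have : Odd (p + r) := by
      by_contra hc
      apply hpr
      rw [Int.not_odd_iff_even] at hc
      rcases Int.even_or_odd p with h | h
      · have h1 : Even r := by grind
        simp [Set.indicator, ← Int.not_even_iff_odd, h, h1]
      · have h1 : Odd r := by grind
        simp [Set.indicator, ← Int.not_odd_iff_even, h, h1]
    obtain ⟨k, hk⟩ := this
    refine ⟨(k, p - k - 1), ?_⟩
    simp only [Prod.mk.injEq]
    omega

section PartialFractions

variable {f A B : ℂ → ℂ}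

lemma map_neg_of_mul_eq (hAB : ∀ x z, f (x + z) * f (x - z) = A x * B z - B x * A z) (z : ℂ) :
    f (-z) = -f z := by
  have key (u v : ℂ) : f u * f v = -(f u * f (-v)) := by
    have h1 := hAB ((u + v) / 2) ((u - v) / 2)
    have h2 := hAB ((u - v) / 2) ((u + v) / 2)
    ring_nf at h1 h2 ⊢
    linear_combination h1 + h2
  by_cases h : f z = 0
  · have := key (-z) z
    have h2 : f (-z) * f (-z) = 0 := by linear_combination this - h * f (-z)
    simpa [h] using h2
  · apply mul_left_cancel₀ h
    linear_combination key z z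

lemma three_term_of_mul_eq (hAB : ∀ x z, f (x + z) * f (x - z) = A x * B z - B x * A z)
    (z b c p q : ℂ) :
    f (z - b) * f (z - c) * (f (p - q) * f (p + q - (b + c))) =
      f (q - c) * f (b - q) * (f (z - p) * f (z - (b + c - p))) -
        f (p - c) * f (b - p) * (f (z - q) * f (z - (b + c - q))) := by
  have e1 : f (z - c) * f (z - b) = A (z - (b + c) / 2) * B ((b - c) / 2) -
      B (z - (b + c) / 2) * A ((b - c) / 2) := by
    rw [← hAB]; congr 2 <;> ring
  have e2 : f (p + q - (b + c)) * f (p - q) = A (p - (b + c) / 2) * B (q - (b + c) / 2) -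
      B (p - (b + c) / 2) * A (q - (b + c) / 2) := by
    rw [← hAB]; congr 2 <;> ring
  have e3 (r : ℂ) : f (z - (b + c - r)) * f (z - r) =
      A (z - (b + c) / 2) * B (r - (b + c) / 2) -
        B (z - (b + c) / 2) * A (r - (b + c) / 2) := by
    rw [← hAB]; congr 2 <;> ring
  have e4 (r : ℂ) : f (r - c) * f (b - r) =
      A ((b - c) / 2) * B (r - (b + c) / 2) - B ((b - c) / 2) * A (r - (b + c) / 2) := by
    rw [← hAB]; congr 2 <;> ring
  rw [mul_comm (f (z - b)), mul_comm (f (p - q)), mul_comm (f (z - p)), mul_comm (f (z - q)),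
    e1, e2, e3, e3, e4, e4]
  ring

variable {ι : Type*} [DecidableEq ι]

lemma sum_prod_div_prod_of_erase (h0 : f 0 = 0) {s : Finset ι} {a b : ι → ℂ} {i j : ι}
    (hi : i ∈ s) (hj : j ∈ s) (hij : i ≠ j) (ha : ∀ k ∈ s, k ≠ i → f (a k - a i) ≠ 0)
    (ih : ∀ b' : ι → ℂ, ∑ k ∈ s.erase i, a k = ∑ k ∈ s.erase i, b' k →
      ∑ k ∈ s.erase i, (∏ l ∈ s.erase i, f (a k - b' l)) /
        ∏ l ∈ (s.erase i).erase k, f (a k - a l) = 0)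
    (hsum : ∑ k ∈ s, a k = ∑ k ∈ s, b k) :
    ∑ k ∈ s, f (a k - a i) * f (a k - (b i + b j - a i)) *
      (∏ l ∈ (s.erase i).erase j, f (a k - b l)) / ∏ l ∈ s.erase k, f (a k - a l) = 0 := by
  have hj' : j ∈ s.erase i := mem_erase.2 ⟨hij.symm, hj⟩
  rw [← add_sum_erase _ _ hi, sub_self, h0, zero_mul, zero_mul, zero_div, zero_add,
    ← ih (Function.update b j (b i + b j - a i))]
  · refine sum_congr rfl fun k hk => ?_
    obtain ⟨hki, hks⟩ := mem_erase.1 hk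
    rw [← mul_prod_erase (s.erase i) _ hj',
      ← mul_prod_erase (s.erase k) _ (mem_erase.2 ⟨hki.symm, hi⟩),
      (erase_right_comm : (s.erase k).erase i = _),
      mul_assoc, mul_div_mul_left _ _ (ha k hks hki), Function.update_self]
    congr 2
    refine prod_congr rfl fun l hl => ?_
    rw [Function.update_of_ne (mem_erase.1 hl).1]
  · rw [← add_sum_erase (s.erase i) _ hj', ← add_sum_erase (s.erase i) (Function.update _ _ _) hj',
      add_sum_erase (s.erase i) _ hj', Function.update_self]
    have : ∑ l ∈ (s.erase i).erase j, Function.update b j (b i + b j - a i) l =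
        ∑ l ∈ (s.erase i).erase j, b l :=
      sum_congr rfl fun l hl => by rw [Function.update_of_ne (mem_erase.1 hl).1]
    rw [this]
    rw [← add_sum_erase s a hi, ← add_sum_erase s b hi, ← add_sum_erase (s.erase i) b hj'] at hsum
    linear_combination hsum

/-- The partial fraction identity for a function satisfying the three-term relation. -/
theorem sum_prod_div_prod_eq_zero (hf : Differentiable ℂ f)
    (hAB : ∀ x z, f (x + z) * f (x - z) = A x * B z - B x * A z)
    (s : Finset ι) (a b : ι → ℂ)
    (ha : ∀ i ∈ s, ∀ j ∈ s, i ≠ j → f (a i - a j) ≠ 0)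
    (hsum : ∑ k ∈ s, a k = ∑ k ∈ s, b k) :
    ∑ k ∈ s, (∏ j ∈ s, f (a k - b j)) / ∏ j ∈ s.erase k, f (a k - a j) = 0 := by
  have hodd := map_neg_of_mul_eq hAB
  have h0 : f 0 = 0 := by simpa [self_eq_neg] using hodd 0
  induction s using Finset.strongInduction generalizing b with
  | H s ih =>
  obtain rfl | ⟨i, hi⟩ := s.eq_empty_or_nonempty
  · simp
  by_cases h1 : s.erase i = ∅
  · obtain rfl : s = {i} := by rw [← insert_erase hi, h1]; simp
    simp only [sum_singleton] at hsum
    simp [hsum, h0]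
  obtain ⟨j, hj⟩ := nonempty_iff_ne_empty.2 h1
  obtain ⟨hji, hjs⟩ := mem_erase.1 hj
  by_cases h2 : (s.erase i).erase j = ∅
  · obtain rfl : s = {i, j} := by rw [← insert_erase hi, ← insert_erase hj, h2]; simp
    have hne := ha i (by simp) j (by simp) hji.symm
    rw [sum_pair hji.symm, sum_pair hji.symm] at hsum
    have e1 : ({i, j} : Finset ι).erase i = {j} := by grind
    have e2 : ({i, j} : Finset ι).erase j = {i} := by grind
    rw [sum_pair hji.symm, prod_pair hji.symm, prod_pair hji.symm, e1, e2, prod_singleton,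
      prod_singleton, ← neg_sub (a i) (a j), hodd,
      show a j - b i = -(a i - b j) by linear_combination hsum,
      show a j - b j = -(a i - b i) by linear_combination hsum, hodd, hodd]
    field_simp
    ring
  obtain ⟨m, hm⟩ := nonempty_iff_ne_empty.2 h2
  obtain ⟨hmj, hm'⟩ := mem_erase.1 hm
  obtain ⟨hmi, hms⟩ := mem_erase.1 hm'
  have key (b : ι → ℂ) (hsum : ∑ k ∈ s, a k = ∑ k ∈ s, b k) :
      (∑ k ∈ s, (∏ j ∈ s, f (a k - b j)) / ∏ j ∈ s.erase k, f (a k - a j)) *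
        f (a i + a j - (b i + b j)) = 0 := by
    have r1 := sum_prod_div_prod_of_erase h0 hi hjs hji.symm (fun k hk hki => ha k hk i hi hki)
      (fun b' hb' => ih _ (erase_ssubset hi) b'
        (fun p hp q hq => ha p (mem_of_mem_erase hp) q (mem_of_mem_erase hq)) hb') hsum
    have r2 := sum_prod_div_prod_of_erase h0 hjs hi hji (fun k hk hki => ha k hk j hjs hki)
      (fun b' hb' => ih _ (erase_ssubset hjs) b'
        (fun p hp q hq => ha p (mem_of_mem_erase hp) q (mem_of_mem_erase hq)) hb') hsum
    rw [erase_right_comm] at r2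
    apply mul_left_cancel₀ (ha i hi j hjs hji.symm)
    rw [mul_zero]
    trans f (a j - b j) * f (b i - a j) * 0 - f (a i - b j) * f (b i - a i) * 0
    · rw [← r1]
      nth_rw 2 [r1]
      rw [← r2, mul_sum, mul_sum, ← sum_sub_distrib, sum_mul, mul_sum]
      refine sum_congr rfl fun k hk => ?_
      have h3 := three_term_of_mul_eq hAB (a k) (b i) (b j) (a i) (a j)
      rw [← mul_prod_erase s _ hi, ← mul_prod_erase (s.erase i) (fun l => f (a k - b l)) hj,
        add_comm (b j)]
      linear_combination
        (∏ l ∈ (s.erase i).erase j, f (a k - b l)) / (∏ l ∈ s.erase k, f (a k - a l)) * h3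
    · ring
  let c : ℂ → ι → ℂ := fun ε => b + Pi.single j ε - Pi.single m ε
  have hc (ε : ℂ) : ∑ k ∈ s, a k = ∑ k ∈ s, c ε k := by
    simp [c, sum_add_distrib, sum_sub_distrib, hjs, hms, hsum]
  have hcd (k : ι) : Differentiable ℂ fun ε => c ε k := by
    have (l : ι) : Differentiable ℂ fun ε : ℂ => (Pi.single l ε : ι → ℂ) k := by
      by_cases h : k = l
      · subst h; simp
      · simp [h]
    exact ((differentiable_const _).add (this j)).sub (this m)
  let F : ℂ → ℂ := fun ε =>
    ∑ k ∈ s, (∏ l ∈ s, f (a k - c ε l)) / ∏ l ∈ s.erase k, f (a k - a l)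
  let G : ℂ → ℂ := fun ε => f (a i + a j - (c ε i + c ε j))
  have hF : Differentiable ℂ F := by
    refine Differentiable.fun_sum fun k _ => Differentiable.div_const ?_ _
    exact Differentiable.fun_finsetProd fun l _ => hf.comp ((differentiable_const _).sub (hcd l))
  have hG : Differentiable ℂ G :=
    hf.comp ((differentiable_const _).sub ((hcd i).add (hcd j)))
  rcases AnalyticOnNhd.eq_zero_or_eq_zero_of_mul_eq_zero (U := Set.univ)
    (hF.differentiableOn.analyticOnNhd isOpen_univ)
    (hG.differentiableOn.analyticOnNhd isOpen_univ)
    (fun ε _ => key (c ε) (hc ε)) isPreconnected_univ with h | h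
  · simpa [F, c] using h 0 trivial
  · refine absurd (h (2 * a j - b i - b j) trivial) ?_
    convert ha i hi j hjs hji.symm using 3
    simp [c, hji.symm, hmi.symm, hmj.symm]
    ring

variable [Fintype ι] {x y : ι → ℂ} {a : ℂ}

lemma sum_erase_sub_sum_erase_add (m n : ι) :
    (∑ i ∈ univ.erase n, x i) - (∑ i ∈ univ.erase m, y i) + a =
      y m - (x n - ((∑ i, x i) - (∑ i, y i) + a)) := by
  rw [← add_sum_erase univ x (mem_univ n), ← add_sum_erase univ y (mem_univ m)]
  ring

lemma sum_cauchy_mul_off_diag (hf : Differentiable ℂ f)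
    (hAB : ∀ x z, f (x + z) * f (x - z) = A x * B z - B x * A z)
    (hyy : ∀ i j, i ≠ j → f (y i - y j) ≠ 0) {i n : ι} (hin : i ≠ n) :
    ∑ m, f (y m - (x i + a)) * f (y m - (x n - ((∑ i, x i) - (∑ i, y i) + a))) *
      (∏ k ∈ (univ.erase i).erase n, f (y m - x k)) / ∏ k ∈ univ.erase m, f (y m - y k) = 0 := by
  have hn : n ∈ univ.erase i := mem_erase.2 ⟨hin.symm, mem_univ n⟩
  set S := (∑ i, x i) - (∑ i, y i) + a with hS
  let b := Function.update (Function.update x i (x i + a)) n (x n - S)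
  have hb : ∀ k ∈ (univ.erase i).erase n, b k = x k := by
    intro k hk
    simp only [mem_erase] at hk
    simp [b, hk.1, hk.2.1]
  have hbi : b i = x i + a := by simp [b, hin]
  have hbn : b n = x n - S := by simp [b]
  have := sum_prod_div_prod_eq_zero hf hAB univ y b (fun i _ j _ => hyy i j) (by
    rw [← add_sum_erase _ b (mem_univ i), ← add_sum_erase _ b hn, sum_congr rfl hb, hbi, hbn, hS,
      ← add_sum_erase _ x (mem_univ i), ← add_sum_erase _ x hn]
    ring)
  rw [← this]
  refine sum_congr rfl fun m _ => ?_
  rw [← mul_prod_erase _ _ (mem_univ i), ← mul_prod_erase _ _ hn, hbi, hbn, mul_assoc]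
  congr 3
  exact prod_congr rfl fun k hk => by rw [hb k hk]

lemma sum_cauchy_mul_diag (hf : Differentiable ℂ f)
    (hAB : ∀ x z, f (x + z) * f (x - z) = A x * B z - B x * A z)
    (hyy : ∀ i j, i ≠ j → f (y i - y j) ≠ 0) (n : ι) (hxy : ∀ j, f (x n - y j) ≠ 0) :
    ∑ m, f (y m - (x n + a)) * f (y m - (x n - ((∑ i, x i) - (∑ i, y i) + a))) *
      (∏ k ∈ univ.erase n, f (y m - x k)) /
        (f (y m - x n) * ∏ k ∈ univ.erase m, f (y m - y k)) =
      f a * f ((∑ i, x i) - (∑ i, y i) + a) * (∏ k ∈ univ.erase n, f (x n - x k)) /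
        ∏ k, f (x n - y k) := by
  have hodd := map_neg_of_mul_eq hAB
  set S := (∑ i, x i) - (∑ i, y i) + a with hS
  let u : Option ι → ℂ := fun o => o.elim (x n) y
  let v : Option ι → ℂ := fun o => o.elim (x n + a) (Function.update x n (x n - S))
  have hv : ∀ k ∈ univ.erase n, Function.update x n (x n - S) k = x k := by
    intro k hk
    simp [(mem_erase.1 hk).1]
  have hprod (z : ℂ) : ∏ o, f (z - v o) =
      f (z - (x n + a)) * f (z - (x n - S)) * ∏ k ∈ univ.erase n, f (z - x k) := by
    rw [Fintype.prod_option, ← mul_prod_erase _ _ (mem_univ n), ← mul_assoc]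
    simp only [v, Option.elim, Function.update_self]
    congr 1
    exact prod_congr rfl fun k hk => by rw [hv k hk]
  have := sum_prod_div_prod_eq_zero hf hAB univ u v (by
      rintro (_ | i) - (_ | j) - hij
      · exact absurd rfl hij
      · exact hxy j
      · simp only [u, Option.elim]
        rw [← neg_sub, hodd]
        exact neg_ne_zero.2 (hxy i)
      · exact hyy i j fun h => hij (by rw [h])) (by
    rw [Fintype.sum_option, Fintype.sum_option]
    simp only [u, v, Option.elim]
    rw [← add_sum_erase _ (Function.update _ _ _) (mem_univ n), sum_congr rfl hv,
      Function.update_self, hS, ← add_sum_erase _ x (mem_univ n)]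
    ring)
  have e1 : (univ : Finset (Option ι)).erase none = univ.map Function.Embedding.some := by
    ext (_ | k) <;> simp
  have e2 (m : ι) : (univ : Finset (Option ι)).erase (some m) = insertNone (univ.erase m) := by
    ext (_ | k) <;> simp
  simp only [hprod, Fintype.sum_option, e1, e2, prod_map, prod_insertNone] at this
  simp only [u, Option.elim, Function.Embedding.some_apply, sub_add_cancel_left, sub_sub_cancel,
    hodd] at this
  rw [← sub_eq_zero, ← this]
  ring

/-- The elliptic Cauchy matrix times its claimed inverse, entrywise. -/
theorem sum_cauchy_mul_inverse (hf : Differentiable ℂ f)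
    (hAB : ∀ x z, f (x + z) * f (x - z) = A x * B z - B x * A z) (ha : f a ≠ 0)
    (hxy : ∀ i j, f (x i - y j) ≠ 0) (hxx : ∀ i j, i ≠ j → f (x i - x j) ≠ 0)
    (hyy : ∀ i j, i ≠ j → f (y i - y j) ≠ 0) (hsum : f ((∑ i, x i) - (∑ i, y i) + a) ≠ 0)
    (i n : ι) :
    ∑ m, f (x i - y m + a) / (f (x i - y m) * f a) *
      (-(f ((∑ i ∈ univ.erase n, x i) - (∑ i ∈ univ.erase m, y i) + a) /
          (f ((∑ i, x i) - (∑ i, y i) + a) * f (x n - y m))) *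
        ((∏ i, f (x n - y i)) * ∏ i, f (y m - x i)) /
        ((∏ i ∈ univ.erase n, f (x n - x i)) * ∏ i ∈ univ.erase m, f (y m - y i))) =
      if i = n then 1 else 0 := by
  have hodd := map_neg_of_mul_eq hAB
  have hyx (i j : ι) : f (y j - x i) ≠ 0 := by
    rw [← neg_sub, hodd]
    exact neg_ne_zero.2 (hxy i j)
  have hR : ∏ k ∈ univ.erase n, f (x n - x k) ≠ 0 :=
    prod_ne_zero_iff.2 fun k hk => hxx n k (mem_erase.1 hk).1.symm
  have hT (m : ι) : ∏ k ∈ univ.erase m, f (y m - y k) ≠ 0 :=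
    prod_ne_zero_iff.2 fun k hk => hyy m k (mem_erase.1 hk).1.symm
  have hP : ∏ k, f (x n - y k) ≠ 0 := prod_ne_zero_iff.2 fun k _ => hxy n k
  have e1 (m : ι) : f (x i - y m + a) = -f (y m - (x i + a)) := by
    rw [← hodd]; congr 1; ring
  have e2 (j m : ι) : f (x j - y m) = -f (y m - x j) := by
    rw [← hodd, neg_sub]
  simp only [sum_erase_sub_sum_erase_add, e1]
  split_ifs with hin
  · subst hin
    have h := sum_cauchy_mul_diag (x := x) (a := a) hf hAB hyy i (hxy i)
    rw [← div_eq_one_iff_eq (by positivity), sum_div] at h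
    rw [← h]
    refine sum_congr rfl fun m _ => ?_
    have := hyx i m
    have := hT m
    rw [← mul_prod_erase univ (fun k => f (y m - x k)) (mem_univ i), e2 i m]
    field_simp
  · have hn : n ∈ univ.erase i := mem_erase.2 ⟨fun h => hin h.symm, mem_univ n⟩
    rw [← mul_zero ((∏ k, f (x n - y k)) / (f a * f ((∑ i, x i) - (∑ i, y i) + a) *
      ∏ k ∈ univ.erase n, f (x n - x k))),
      ← sum_cauchy_mul_off_diag (x := x) (a := a) hf hAB hyy hin, mul_sum]
    refine sum_congr rfl fun m _ => ?_
    have := hyx i m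
    have := hyx n m
    have := hT m
    rw [← mul_prod_erase univ (fun k => f (y m - x k)) (mem_univ i),
      ← mul_prod_erase (univ.erase i) (fun k => f (y m - x k)) hn, e2 i m, e2 n m]
    field_simp

end PartialFractions

/-- Inverse of the elliptic Cauchy matrix. -/
theorem elliptic_cauchy_inverse
    (N : ℕ) (hN : 1 ≤ N) (x y : Fin N → ℂ) (a τ : ℂ) (hτ : 0 < τ.im)
    (ha : jacobiTheta1 a τ ≠ 0)
    (hxy : ∀ i j, jacobiTheta1 (x i - y j) τ ≠ 0)
    (hxx : ∀ i j, i ≠ j → jacobiTheta1 (x i - x j) τ ≠ 0)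
    (hyy : ∀ i j, i ≠ j → jacobiTheta1 (y i - y j) τ ≠ 0)
    (hsum : jacobiTheta1 ((∑ i, x i) - (∑ i, y i) + a) τ ≠ 0) :
    IsUnit (Matrix.of fun i j : Fin N =>
        jacobiTheta1 (x i - y j + a) τ /
          (jacobiTheta1 (x i - y j) τ * jacobiTheta1 a τ)).det ∧
      ∀ m n : Fin N,
        (Matrix.of fun i j : Fin N =>
            jacobiTheta1 (x i - y j + a) τ /
              (jacobiTheta1 (x i - y j) τ * jacobiTheta1 a τ))⁻¹ m n =
          -(jacobiTheta1 ((∑ i ∈ univ.erase n, x i) - (∑ i ∈ univ.erase m, y i) + a) τ /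
              (jacobiTheta1 ((∑ i, x i) - (∑ i, y i) + a) τ *
                jacobiTheta1 (x n - y m) τ)) *
            ((∏ i : Fin N, jacobiTheta1 (x n - y i) τ) *
              ∏ i : Fin N, jacobiTheta1 (y m - x i) τ) /
            ((∏ i ∈ univ.erase n, jacobiTheta1 (x n - x i) τ) *
              ∏ i ∈ univ.erase m, jacobiTheta1 (y m - y i) τ) := by
  have key := fun i n => sum_cauchy_mul_inverse (differentiable_jacobiTheta1 hτ)
    (jacobiTheta1_add_mul_sub hτ) ha hxy hxx hyy hsum i n
  have hmul := Matrix.ext (M := Matrix.of (fun i j => jacobiTheta1 (x i - y j + a) τ /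
      (jacobiTheta1 (x i - y j) τ * jacobiTheta1 a τ)) * Matrix.of (fun _ _ => _)) (N := 1)
    fun i n => (Matrix.mul_apply.trans (key i n)).trans Matrix.one_apply.symm
  exact ⟨Matrix.isUnit_det_of_right_inverse hmul, fun m n =>
    congrFun (congrFun (Matrix.inv_eq_right_inv hmul) m) n⟩
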